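/- arXiv:2602.23025 — 2 statements merged into one kernel-verified Lean document; each statement's English description precedes it below -/
import Mathlib

section
/- Let m, p ∈ ℕ, let g : (0,∞) → ℝ lie in D^p ∩ K^{p+m}, and let f₀ : (0,∞) → ℝ satisfy Δ^{m+1} f₀ = g on (0,∞), f₀(k) = 0 for k = 1,…,m+1, and Δ^k f₀ ∈ K^{p+m} for k = 0,…,m. Then for every f : (0,∞) → ℝ with Δ^{m+1} f = g on (0,∞), the following are equivalent: (i) Δ^k f ∈ K^{p+m} for k = 0,…,m; (ii) f − f₀ agrees on (0,∞) with a polynomial of degree at most m. In particular, f₀ is the unique solution of Δ^{m+1} f = g satisfying both Δ^k f ∈ K^{p+m} and f(k+1) = 0 for k = 0,…,m. -/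
open Finset Filter

/-- Forward difference operator: `Δ f x = f (x + 1) - f x`. -/
noncomputable def fdiff (f : ℝ → ℝ) : ℝ → ℝ := fun x => f (x + 1) - f x

/-- Generalized binomial coefficient `C(x, j) = x (x-1) ⋯ (x-j+1) / j!`. -/
noncomputable def gbinom (x : ℝ) (j : ℕ) : ℝ :=
  (∏ i ∈ Finset.range j, (x - i)) / (Nat.factorial j)

/-- Divided difference of `f` at the points `x 0, …, x (n-1)`. -/
noncomputable def divDiff (f : ℝ → ℝ) {n : ℕ} (x : Fin n → ℝ) : ℝ :=
  ∑ i, f (x i) / ∏ j ∈ Finset.univ.erase i, (x i - x j)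

/-- `f` is `p`-convex on the set `S`: every divided difference of `f`
at `p + 2` pairwise distinct points of `S` is nonnegative. -/
def ConvexOrderOn (f : ℝ → ℝ) (p : ℕ) (S : Set ℝ) : Prop :=
  ∀ x : Fin (p + 2) → ℝ, (∀ i, x i ∈ S) → Function.Injective x → 0 ≤ divDiff f x

/-- The class `K^p`: functions that are eventually `p`-convex or eventually `p`-concave. -/
def EvK (p : ℕ) (f : ℝ → ℝ) : Prop :=
  (∃ a > (0 : ℝ), ConvexOrderOn f p (Set.Ioi a)) ∨
    (∃ a > (0 : ℝ), ConvexOrderOn (fun x => -f x) p (Set.Ioi a))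

/-- The class `D^p`: functions with `Δ^p f (n) → 0` as `n → ∞` along the integers. -/
def DD (p : ℕ) (f : ℝ → ℝ) : Prop :=
  Filter.Tendsto (fun n : ℕ => (fdiff^[p] f) n) Filter.atTop (nhds 0)

/-- The digamma function `ψ = Γ'/Γ`. -/
noncomputable def digamma (x : ℝ) : ℝ := deriv Real.Gamma x / Real.Gamma x

/-- A multiple-gamma sequence: `G 0 = id`, `G (m+1) (x+1) = G m x * G (m+1) x`,
`G m 1 = 1`, each `G m` is positive and `C^∞` on `(0,∞)`, and the `m`-th derivative
of `ln ∘ G m` is increasing on `(0,∞)`. -/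
def IsMultipleGammaSeq (G : ℕ → ℝ → ℝ) : Prop :=
  (∀ m, ∀ x > (0 : ℝ), 0 < G m x) ∧
  (∀ m, ContDiffOn ℝ (⊤ : ℕ∞) (G m) (Set.Ioi 0)) ∧
  (∀ x > (0 : ℝ), G 0 x = x) ∧
  (∀ m, ∀ x > (0 : ℝ), G (m + 1) (x + 1) = G m x * G (m + 1) x) ∧
  (∀ m, G m 1 = 1) ∧
  (∀ m, StrictMonoOn
    (iteratedDerivWithin m (fun x => Real.log (G m x)) (Set.Ioi 0)) (Set.Ioi 0))

theorem fdiff_eq_fwdDiff : fdiff = fwdDiff (1 : ℝ) := rfl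

theorem fdiff_iterate_add (f g : ℝ → ℝ) (n : ℕ) (x : ℝ) :
    fdiff^[n] (fun y => f y + g y) x = fdiff^[n] f x + fdiff^[n] g x :=
  congrFun (fwdDiff_iter_add (1 : ℝ) f g n) x

theorem fdiff_iterate_neg (f : ℝ → ℝ) (n : ℕ) (x : ℝ) :
    fdiff^[n] (fun y => -f y) x = -fdiff^[n] f x := by
  have h := congrFun (fwdDiff_iter_const_smul (1 : ℝ) (-1 : ℝ) f n) x
  have e : (-1 : ℝ) • f = fun y => -f y := by ext; simp
  rw [e] at h
  simpa [fdiff_eq_fwdDiff] using h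

theorem fdiff_iterate_congr {f g : ℝ → ℝ} (h : ∀ x > 0, f x = g x) (n : ℕ) :
    ∀ x > 0, fdiff^[n] f x = fdiff^[n] g x := by
  induction n with
  | zero => simpa using h
  | succ n ih =>
    intro x hx
    simp only [Function.iterate_succ_apply', fdiff, ih x hx, ih (x + 1) (by linarith)]

theorem fdiff_iterate_polynomial (P : Polynomial ℝ) (n : ℕ) :
    ∃ Q : Polynomial ℝ, Q.natDegree ≤ P.natDegree ∧ fdiff^[n] (fun x => P.eval x) = Q.eval := by
  induction n with
  | zero => exact ⟨P, le_rfl, rfl⟩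
  | succ n ih =>
    obtain ⟨Q, hQ, h⟩ := ih
    refine ⟨Q.comp (.X + .C 1) - Q, ?_, ?_⟩
    · refine Polynomial.natDegree_sub_le_of_le ?_ hQ |>.trans (max_self _).le
      exact Polynomial.natDegree_comp_le.trans (by rw [Polynomial.natDegree_X_add_C, mul_one]; exact hQ)
    · rw [Function.iterate_succ_apply', h]
      ext x
      simp [fdiff]

theorem tendsto_fdiff_iterate_add {f : ℝ → ℝ} {n : ℕ}
    (h : Tendsto (fun k : ℕ => fdiff^[n] f k) atTop (nhds 0)) (j : ℕ) :
    Tendsto (fun k : ℕ => fdiff^[n + j] f k) atTop (nhds 0) := by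
  induction j with
  | zero => exact h
  | succ j ih =>
    have h1 := ((tendsto_add_atTop_iff_nat 1).2 ih).sub ih
    simpa only [← add_assoc, Function.iterate_succ_apply', fdiff, Nat.cast_add, Nat.cast_one,
      sub_zero] using h1

section DividedDifferences

variable {n : ℕ}

theorem divDiff_congr {f g : ℝ → ℝ} {x : Fin n → ℝ} (h : ∀ i, f (x i) = g (x i)) :
    divDiff f x = divDiff g x := by
  simp only [divDiff, h]

theorem divDiff_add (f g : ℝ → ℝ) (x : Fin n → ℝ) :
    divDiff (fun y => f y + g y) x = divDiff f x + divDiff g x := by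
  simp only [divDiff, add_div, Finset.sum_add_distrib]

theorem divDiff_neg (f : ℝ → ℝ) (x : Fin n → ℝ) :
    divDiff (fun y => -f y) x = -divDiff f x := by
  simp only [divDiff, neg_div, Finset.sum_neg_distrib]

theorem divDiff_sub (f g : ℝ → ℝ) (x : Fin n → ℝ) :
    divDiff (fun y => f y - g y) x = divDiff f x - divDiff g x := by
  simp only [divDiff, sub_div, Finset.sum_sub_distrib]

theorem divDiff_polynomial {P : Polynomial ℝ} (hP : P.natDegree + 1 < n) {x : Fin n → ℝ}
    (hx : Function.Injective x) : divDiff (fun y => P.eval y) x = 0 := by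
  have h := Lagrange.coeff_eq_sum (s := Finset.univ) (v := x) hx.injOn (P := P)
    (Polynomial.degree_le_natDegree.trans_lt (by simp; omega))
  rw [divDiff, ← h]
  exact Polynomial.coeff_eq_zero_of_natDegree_lt (by simp; omega)

theorem prod_erase_succAbove (x : Fin (n + 1) → ℝ) (c : Fin (n + 1)) (i : Fin n) :
    ∏ j ∈ Finset.univ.erase (c.succAbove i), (x (c.succAbove i) - x j) =
      (x (c.succAbove i) - x c) *
        ∏ j ∈ Finset.univ.erase i, (x (c.succAbove i) - x (c.succAbove j)) := by
  have e : Finset.univ.erase (c.succAbove i) =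
      Finset.cons c ((Finset.univ.erase i).map c.succAboveEmb) (by simp) := by
    rw [Fin.univ_succAbove n c]
    ext j
    rcases Fin.eq_self_or_eq_succAbove c j with rfl | ⟨k, rfl⟩ <;> simp [Fin.ne_succAbove]
  rw [e, Finset.prod_cons, Finset.prod_map]
  rfl

theorem divDiff_succAbove (f : ℝ → ℝ) {x : Fin (n + 1) → ℝ} (hx : Function.Injective x)
    (c : Fin (n + 1)) :
    divDiff f (fun i => x (c.succAbove i)) =
      ∑ i, (x i - x c) * (f (x i) / ∏ j ∈ Finset.univ.erase i, (x i - x j)) := by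
  rw [Fin.sum_univ_succAbove _ c, sub_self, zero_mul, zero_add, divDiff]
  refine Finset.sum_congr rfl fun i _ => ?_
  have h : x (c.succAbove i) - x c ≠ 0 :=
    sub_ne_zero.2 fun h => Fin.succAbove_ne c i (hx h)
  rw [prod_erase_succAbove, ← mul_div_assoc, mul_div_mul_left _ _ h]

theorem divDiff_recurrence (f : ℝ → ℝ) {x : Fin (n + 1) → ℝ} (hx : Function.Injective x)
    (a b : Fin (n + 1)) :
    divDiff f (fun i => x (a.succAbove i)) - divDiff f (fun i => x (b.succAbove i)) =
      (x b - x a) * divDiff f x := by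
  rw [divDiff_succAbove f hx, divDiff_succAbove f hx, divDiff, ← Finset.sum_sub_distrib,
    Finset.mul_sum]
  exact Finset.sum_congr rfl fun i _ => by ring

theorem divDiff_exchange (f : ℝ → ℝ) {x : Fin (n + 1) → ℝ} (hx : Function.Injective x)
    (a b c : Fin (n + 1)) :
    (x c - x a) * divDiff f (fun i => x (b.succAbove i)) +
        (x b - x c) * divDiff f (fun i => x (a.succAbove i)) =
      (x b - x a) * divDiff f (fun i => x (c.succAbove i)) := by
  have h1 := divDiff_recurrence f hx a c
  have h2 := divDiff_recurrence f hx b c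
  linear_combination (x b - x c) * h1 + (x c - x a) * h2

theorem divDiff_equispaced (f : ℝ → ℝ) (n : ℕ) (t : ℝ) :
    n.factorial * divDiff f (fun i : Fin (n + 1) => t + i) = fdiff^[n] f t := by
  induction n generalizing t with
  | zero => simp [divDiff]
  | succ n ih =>
    have hx : Function.Injective (fun i : Fin (n + 2) => t + (i : ℝ)) := fun i j h => by
      simpa [Fin.ext_iff] using h
    have h := divDiff_recurrence f hx 0 (Fin.last _)
    have e : (fun i : Fin (n + 1) => t + ((i.succ : Fin (n + 2)) : ℝ)) =
        fun i : Fin (n + 1) => t + 1 + i := by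
      ext i
      push_cast [Fin.val_succ]
      ring
    simp only [Fin.succAbove_zero, Fin.succAbove_last, Fin.val_castSucc, e, Fin.val_last,
      Fin.val_zero, Nat.cast_zero] at h
    rw [Function.iterate_succ_apply', fdiff, ← ih, ← ih, ← mul_sub, h, Nat.factorial_succ]
    push_cast
    ring

end DividedDifferences

theorem convexOrderOn_add_polynomial {f : ℝ → ℝ} {q : ℕ} {S : Set ℝ} (hf : ConvexOrderOn f q S)
    {P : Polynomial ℝ} (hP : P.natDegree ≤ q) :
    ConvexOrderOn (fun x => f x + P.eval x) q S := by
  intro x hxS hx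
  rw [divDiff_add, divDiff_polynomial (by omega) hx, add_zero]
  exact hf x hxS hx

theorem convexOrderOn_congr {f g : ℝ → ℝ} {q : ℕ} {S : Set ℝ} (hf : ConvexOrderOn f q S)
    (h : ∀ x ∈ S, g x = f x) : ConvexOrderOn g q S := by
  intro x hxS hx
  rw [divDiff_congr fun i => h _ (hxS i)]
  exact hf x hxS hx

theorem EvK.add_polynomial {f g : ℝ → ℝ} {q : ℕ} (hf : EvK q f) {P : Polynomial ℝ}
    (hP : P.natDegree ≤ q) (h : ∀ x > 0, g x = f x + P.eval x) : EvK q g := by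
  rcases hf with ⟨a, ha, hf⟩ | ⟨a, ha, hf⟩
  · exact .inl ⟨a, ha, convexOrderOn_congr (convexOrderOn_add_polynomial hf hP)
      fun x hx => h x (ha.trans hx)⟩
  · refine .inr ⟨a, ha, convexOrderOn_congr
      (convexOrderOn_add_polynomial hf (P := -P) (by simpa using hP)) fun x hx => ?_⟩
    rw [h x (ha.trans hx), Polynomial.eval_neg]
    ring

theorem EvK.fdiff_iterate_add_polynomial {f g : ℝ → ℝ} {q k : ℕ} (hf : EvK q (fdiff^[k] f))
    {P : Polynomial ℝ} (hP : P.natDegree ≤ q) (h : ∀ x > 0, g x = f x + P.eval x) :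
    EvK q (fdiff^[k] g) := by
  obtain ⟨Q, hQ, hQP⟩ := fdiff_iterate_polynomial P k
  refine hf.add_polynomial (hQ.trans hP) fun x hx => ?_
  rw [fdiff_iterate_congr h k x hx, fdiff_iterate_add, hQP]

/-- The nodes `x, 0, 1, …, q - 1`. -/
noncomputable def consNodes (x : ℝ) (q : ℕ) : Fin (q + 1) → ℝ :=
  Fin.cons x fun i : Fin q => (i : ℝ)

theorem consNodes_injective {x : ℝ} (hx0 : 0 < x) (hx1 : x < 1) (q : ℕ) :
    Function.Injective (consNodes x q) := by
  rw [consNodes, Fin.cons_injective_iff]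
  refine ⟨?_, fun i j h => by simpa [Fin.ext_iff] using h⟩
  rintro ⟨i, hi⟩
  rw [← hi] at hx0 hx1
  exact (Nat.cast_pos.1 hx0).ne' (Nat.cast_lt_one.1 hx1)

theorem consNodes_castSucc (x : ℝ) (q : ℕ) (i : Fin (q + 1)) :
    consNodes x (q + 1) i.castSucc = consNodes x q i := by
  cases i using Fin.cases with
  | zero => rfl
  | succ i => simp [consNodes]

theorem consNodes_nonneg {x : ℝ} (hx0 : 0 < x) (q : ℕ) (i : Fin (q + 1)) :
    0 ≤ consNodes x q i := by
  cases i using Fin.cases with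
  | zero => exact hx0.le
  | succ i => simp [consNodes]

theorem ConvexOrderOn.tendsto_divDiff {f : ℝ → ℝ} {q : ℕ} {a : ℝ}
    (hf : ConvexOrderOn f q (Set.Ioi a))
    (hlim : Tendsto (fun n : ℕ => fdiff^[q + 1] f n) atTop (nhds 0))
    {x : ℝ} (hx0 : 0 < x) (hx1 : x < 1) :
    Tendsto (fun n : ℕ => divDiff f (fun i => n + consNodes x (q + 1) i)) atTop (nhds 0) := by
  have hinj (n : ℕ) : Function.Injective (fun i => (n : ℝ) + consNodes x (q + 2) i) :=
    (add_right_injective _).comp (consNodes_injective hx0 hx1 _)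
  have hpos : ∀ᶠ n : ℕ in atTop, ∀ c : Fin (q + 3),
      0 ≤ divDiff f (fun i => n + consNodes x (q + 2) (c.succAbove i)) := by
    filter_upwards [tendsto_natCast_atTop_atTop.eventually_gt_atTop a] with n hn c
    refine hf _ (fun i => ?_) ((hinj n).comp (Fin.succAbove_right_injective))
    exact lt_of_lt_of_le hn (le_add_of_nonneg_right (consNodes_nonneg hx0 _ _))
  have key (n : ℕ) :
      x * divDiff f (fun i => n + consNodes x (q + 1) i) +
        (q + 1 - x) * divDiff f (fun i => n + consNodes x (q + 2) (Fin.succAbove 1 i)) =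
      (q + 1) * (fdiff^[q + 1] f n / (q + 1).factorial) := by
    have h := divDiff_exchange f (hinj n) 1 (Fin.last _) 0
    have e0 : consNodes x (q + 2) 0 = x := rfl
    have e1 : consNodes x (q + 2) 1 = 0 := by
      rw [← Fin.succ_zero_eq_one, consNodes, Fin.cons_succ]
      simp
    have e2 : consNodes x (q + 2) (Fin.last _) = q + 1 := by
      rw [← Fin.succ_last, consNodes, Fin.cons_succ]
      simp
    have e3 (i : Fin (q + 2)) : consNodes x (q + 2) i.succ = i := rfl
    simp only [Fin.succAbove_zero, Fin.succAbove_last, consNodes_castSucc, e0, e1, e2, e3] at h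
    rw [← divDiff_equispaced, mul_div_cancel_left₀ _ (by positivity)]
    linear_combination h
  have hup : Tendsto (fun n : ℕ => (q + 1) * (fdiff^[q + 1] f n / (q + 1).factorial) / x)
      atTop (nhds 0) := by
    simpa using ((hlim.div_const ((q + 1).factorial : ℝ)).const_mul ((q : ℝ) + 1)).div_const x
  refine tendsto_of_tendsto_of_tendsto_of_le_of_le' tendsto_const_nhds hup ?_ ?_
  · filter_upwards [hpos] with n hn
    simpa only [Fin.succAbove_last, consNodes_castSucc] using hn (Fin.last _)
  · filter_upwards [hpos] with n hn
    rw [le_div_iff₀ hx0, ← key n]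
    have hq : (0 : ℝ) ≤ q := q.cast_nonneg
    nlinarith [mul_nonneg (show 0 ≤ (q : ℝ) + 1 - x by linarith) (hn 1)]

theorem EvK.tendsto_divDiff {f : ℝ → ℝ} {q : ℕ} (hf : EvK q f)
    (hlim : Tendsto (fun n : ℕ => fdiff^[q + 1] f n) atTop (nhds 0))
    {x : ℝ} (hx0 : 0 < x) (hx1 : x < 1) :
    Tendsto (fun n : ℕ => divDiff f (fun i => n + consNodes x (q + 1) i)) atTop (nhds 0) := by
  rcases hf with ⟨a, -, hf⟩ | ⟨a, -, hf⟩
  · exact hf.tendsto_divDiff hlim hx0 hx1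
  · have h := (hf.tendsto_divDiff (by simpa only [fdiff_iterate_neg, neg_zero] using hlim.neg)
      hx0 hx1).neg
    simpa only [divDiff_neg, neg_neg, neg_zero] using h

theorem periodic_eq_add_nat {w : ℝ → ℝ} (hw : ∀ x > 0, w (x + 1) = w x) {x : ℝ} (hx : 0 < x)
    (n : ℕ) : w (n + x) = w x := by
  induction n with
  | zero => simp
  | succ n ih =>
    rw [← ih, ← hw (n + x) (by positivity)]
    push_cast
    ring_nf

/-- Two functions in `K^q` with the same difference are equal up to a constant, as soon as
their differences of order `q + 1` vanish at infinity. -/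
theorem EvK.eq_add_const {f g : ℝ → ℝ} {q : ℕ} (hf : EvK q f) (hg : EvK q g)
    (hfg : ∀ x > 0, fdiff f x = fdiff g x)
    (hlim : Tendsto (fun n : ℕ => fdiff^[q + 1] f n) atTop (nhds 0)) :
    ∃ c : ℝ, ∀ x > 0, f x = g x + c := by
  have hlim' : Tendsto (fun n : ℕ => fdiff^[q + 1] g n) atTop (nhds 0) := by
    refine hlim.congr' ?_
    filter_upwards [eventually_gt_atTop 0] with n hn
    rw [Function.iterate_succ_apply, Function.iterate_succ_apply]
    exact fdiff_iterate_congr hfg q n (by exact_mod_cast hn)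
  set w : ℝ → ℝ := fun x => f x - g x with hw
  have hper : ∀ x > 0, w (x + 1) = w x := fun x hx => by
    have := hfg x hx
    simp only [fdiff] at this
    simp only [hw]
    linarith
  have hnat (n : ℕ) (hn : 0 < n) : w n = w 1 := by
    obtain ⟨n, rfl⟩ := Nat.exists_eq_succ_of_ne_zero hn.ne'
    rw [Nat.cast_succ]
    exact periodic_eq_add_nat hper one_pos n
  have hfract (x : ℝ) (hx0 : 0 < x) (hx1 : x < 1) : w x = w 1 := by
    set K : ℝ := ∏ j ∈ Finset.univ.erase 0, (x - consNodes x (q + 1) j) with hK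
    have hK0 : K ≠ 0 := Finset.prod_ne_zero_iff.2 fun j hj => sub_ne_zero.2 fun h =>
      Finset.ne_of_mem_erase hj (consNodes_injective hx0 hx1 _ h.symm)
    have hval : ∀ᶠ n : ℕ in atTop,
        divDiff w (fun i => n + consNodes x (q + 1) i) = (w x - w 1) / K := by
      filter_upwards [eventually_gt_atTop 0] with n hn
      have hinj : Function.Injective (fun i => (n : ℝ) + consNodes x (q + 1) i) :=
        (add_right_injective _).comp (consNodes_injective hx0 hx1 _)
      have hconst := divDiff_polynomial (P := .C (w 1)) (by simp) hinj
      have hsub := divDiff_sub w (fun y => (Polynomial.C (w 1)).eval y)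
        (fun i => (n : ℝ) + consNodes x (q + 1) i)
      rw [hconst, sub_zero] at hsub
      rw [← hsub, divDiff, Fin.sum_univ_succ, Finset.sum_eq_zero, add_zero]
      · have e0 : consNodes x (q + 1) 0 = x := rfl
        simp only [Polynomial.eval_C, e0, add_sub_add_left_eq_sub, ← hK,
          periodic_eq_add_nat hper hx0 n]
      · intro i _
        have e : (n : ℝ) + consNodes x (q + 1) i.succ = (n + i : ℕ) := by simp [consNodes]
        rw [e, hnat _ (by omega), Polynomial.eval_C, sub_self, zero_div]
    have hz : Tendsto (fun n : ℕ => divDiff w (fun i => n + consNodes x (q + 1) i))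
        atTop (nhds 0) := by
      simpa only [hw, divDiff_sub, sub_zero] using
        (hf.tendsto_divDiff hlim hx0 hx1).sub (hg.tendsto_divDiff hlim' hx0 hx1)
    have h0 := tendsto_nhds_unique (hz.congr' hval) tendsto_const_nhds
    have := (div_eq_zero_iff.1 h0.symm).resolve_right hK0
    linarith
  refine ⟨w 1, fun x hx => ?_⟩
  suffices w x = w 1 by simp only [hw] at this ⊢; linarith
  have hx' : x = ⌊x⌋₊ + Int.fract x := by
    rw [natCast_floor_eq_intCast_floor hx.le, Int.floor_add_fract]
  rcases (Int.fract_nonneg x).eq_or_lt with h | h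
  · rw [← h, add_zero] at hx'
    rw [hx']
    exact hnat _ (by rw [hx'] at hx; exact_mod_cast hx)
  · rw [hx', periodic_eq_add_nat hper h, hfract _ h (Int.fract_lt_one x)]

theorem exists_polynomial_of_fdiff_iterate_eq {q k : ℕ} (hk : k ≤ q + 1) {f g : ℝ → ℝ}
    (hf : ∀ j < k, EvK q (fdiff^[j] f)) (hg : ∀ j < k, EvK q (fdiff^[j] g))
    (hfg : ∀ x > 0, fdiff^[k] f x = fdiff^[k] g x)
    (hlim : Tendsto (fun n : ℕ => fdiff^[q + 1] f n) atTop (nhds 0)) :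
    ∃ P : Polynomial ℝ, P.natDegree ≤ k - 1 ∧ ∀ x > 0, f x = g x + P.eval x := by
  induction k generalizing g with
  | zero => exact ⟨0, by simp, by simpa using hfg⟩
  | succ k ih =>
    obtain ⟨c, hc⟩ := (hf k k.lt_succ_self).eq_add_const (hg k k.lt_succ_self)
      (by simpa only [Function.iterate_succ_apply'] using hfg)
      (by
        have h := tendsto_fdiff_iterate_add hlim k
        simpa only [Function.iterate_add_apply] using h)
    set R : Polynomial ℝ := .C (c / k.factorial) * .X ^ k with hR
    have hRdeg : R.natDegree ≤ k := Polynomial.natDegree_C_mul_X_pow_le _ _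
    have hRdiff (x : ℝ) : fdiff^[k] (fun y => R.eval y) x = c := by
      have e : (fun y => R.eval y) = (c / k.factorial) • fun y : ℝ => y ^ k := by
        ext y
        simp [hR]
      rw [e, fdiff_eq_fwdDiff, fwdDiff_iter_const_smul, fwdDiff_iter_eq_factorial]
      simp [div_mul_cancel₀ _ (show (k.factorial : ℝ) ≠ 0 by positivity)]
    obtain ⟨P, hP, h⟩ := ih (g := fun x => g x + R.eval x) (by omega)
      (fun j hj => hf j (by omega))
      (fun j hj => (hg j (by omega)).fdiff_iterate_add_polynomial (by omega) fun _ _ => rfl)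
      (fun x hx => by rw [hc x hx, fdiff_iterate_add, hRdiff])
    refine ⟨R + P, ?_, fun x hx => ?_⟩
    · exact Polynomial.natDegree_add_le_of_degree_le hRdeg (by omega)
    · rw [h x hx, Polynomial.eval_add, add_assoc]

/-- Bohr–Mollerup-type characterization of the `(m+1)`-fold principal indefinite sum. -/
theorem stmt_4 (m p : ℕ) (g : ℝ → ℝ) (hgD : DD p g) (hgK : EvK (p + m) g)
    (f₀ : ℝ → ℝ) (hf₀Δ : ∀ x > (0 : ℝ), fdiff^[m + 1] f₀ x = g x)
    (hf₀0 : ∀ k ∈ Finset.Icc 1 (m + 1), f₀ k = 0)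
    (hf₀K : ∀ k ≤ m, EvK (p + m) (fdiff^[k] f₀)) :
    (∀ f : ℝ → ℝ, (∀ x > (0 : ℝ), fdiff^[m + 1] f x = g x) →
      ((∀ k ≤ m, EvK (p + m) (fdiff^[k] f)) ↔
        ∃ P : Polynomial ℝ, P.natDegree ≤ m ∧ ∀ x > (0 : ℝ), f x = f₀ x + P.eval x)) ∧
    (∀ f : ℝ → ℝ, (∀ x > (0 : ℝ), fdiff^[m + 1] f x = g x) →
      (∀ k ≤ m, EvK (p + m) (fdiff^[k] f)) →
      (∀ k ≤ m, f (k + 1) = 0) →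
      ∀ x > (0 : ℝ), f x = f₀ x) := by
  have hlim {f : ℝ → ℝ} (hf : ∀ x > (0 : ℝ), fdiff^[m + 1] f x = g x) :
      Tendsto (fun n : ℕ => fdiff^[p + m + 1] f n) atTop (nhds 0) := by
    refine hgD.congr' ?_
    filter_upwards [eventually_gt_atTop 0] with n hn
    rw [add_assoc, Function.iterate_add_apply]
    exact (fdiff_iterate_congr hf p n (by exact_mod_cast hn)).symm
  have hpoly (f : ℝ → ℝ) (hf : ∀ x > (0 : ℝ), fdiff^[m + 1] f x = g x)
      (hfK : ∀ k ≤ m, EvK (p + m) (fdiff^[k] f)) :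
      ∃ P : Polynomial ℝ, P.natDegree ≤ m ∧ ∀ x > (0 : ℝ), f x = f₀ x + P.eval x :=
    exists_polynomial_of_fdiff_iterate_eq (q := p + m) (k := m + 1) (by omega)
      (fun j hj => hfK j (by omega)) (fun j hj => hf₀K j (by omega))
      (fun x hx => (hf x hx).trans (hf₀Δ x hx).symm) (hlim hf)
  refine ⟨fun f hf => ⟨hpoly f hf, ?_⟩, fun f hf hfK hf0 x hx => ?_⟩
  · rintro ⟨P, hP, h⟩ k hk
    exact (hf₀K k hk).fdiff_iterate_add_polynomial (by omega) h
  · obtain ⟨P, hP, h⟩ := hpoly f hf hfK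
    have hP0 : P = 0 := by
      refine Polynomial.eq_zero_of_natDegree_lt_card_of_eval_eq_zero P
        (f := fun i : Fin (m + 1) => (i : ℝ) + 1) (fun i j hij => ?_) (fun i => ?_)
        (by simpa using Nat.lt_succ_of_le hP)
      · simpa [Fin.ext_iff] using hij
      · have h1 := h ((i : ℝ) + 1) (by positivity)
        have h2 := hf₀0 (i + 1) (by simp; omega)
        push_cast at h2
        rw [h2, hf0 i (by omega), zero_add] at h1
        exact h1.symm
    simpa [hP0] using h x hx
end

section
/- Let (G_m) be a multiple-gamma sequence. Then for every m ∈ ℕ and every x > 0, ln G_{m+1}(x) = ∫_0^∞ [ C(x−1, m+1) − (e^{(1−x)t} − 1)/(e^{−t} − 1)^{m+1} + Σ_{j=1}^{m} C(x−1, j)/(e^{−t} − 1)^{m+1−j} ] · (e^{−t}/t) dt, the integral being convergent. (For m = 0 this is Malmstén's formula for ln Γ.) -/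
open Finset Filter

open MeasureTheory

/-- Iterated Rolle theorem: a function with `p + 1` zeros has a zero of its `p`-th derivative. -/
lemma exists_iterated_deriv_eq_zero {p : ℕ} {F : ℕ → ℝ → ℝ} {l u : ℝ}
    (hF : ∀ k < p, ∀ y ∈ Set.Icc l u, HasDerivAt (F k) (F (k + 1) y) y)
    {z : Fin (p + 1) → ℝ} (hz : StrictMono z) (hzI : ∀ i, z i ∈ Set.Icc l u)
    (h0 : ∀ i, F 0 (z i) = 0) : ∃ ξ ∈ Set.Icc l u, F p ξ = 0 := by
  induction p generalizing F with
  | zero => exact ⟨z 0, hzI 0, h0 0⟩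
  | succ p ih =>
    have key (i : Fin (p + 1)) : ∃ ξ ∈ Set.Ioo (z i.castSucc) (z i.succ), F 1 ξ = 0 := by
      have hsub : ∀ y ∈ Set.Icc (z i.castSucc) (z i.succ), y ∈ Set.Icc l u := fun y hy =>
        ⟨(hzI _).1.trans hy.1, hy.2.trans (hzI _).2⟩
      exact exists_hasDerivAt_eq_zero (hz i.castSucc_lt_succ)
        (fun y hy => (hF 0 (by lia) y (hsub y hy)).continuousAt.continuousWithinAt)
        (by rw [h0, h0])
        (fun y hy => hF 0 (by lia) y (hsub y ⟨hy.1.le, hy.2.le⟩))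
    choose w hw hw0 using key
    refine ih (F := fun k => F (k + 1)) (fun k hk => hF (k + 1) (by lia)) (z := w) ?_ ?_ hw0
    · intro i j hij
      have : z i.succ ≤ z j.castSucc := hz.monotone (Fin.succ_le_castSucc_iff.2 hij)
      exact ((hw i).2.trans_le this).trans (hw j).1
    · exact fun i => ⟨(hzI _).1.trans (hw i).1.le, (hw i).2.le.trans (hzI _).2⟩

lemma gbinom_eq_eval (x : ℝ) (j : ℕ) :
    gbinom x j = (descPochhammer ℝ j).eval x / (Nat.factorial j) := by
  rw [gbinom, descPochhammer_eval_eq_prod_range]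

lemma gbinom_natCast (k j : ℕ) : gbinom k j = k.choose j := by
  rw [gbinom_eq_eval, descPochhammer_eval_eq_descFactorial, Nat.descFactorial_eq_factorial_mul_choose,
    Nat.cast_mul, mul_div_cancel_left₀ _ (by positivity)]

lemma gbinom_eq_choose (x : ℝ) (j : ℕ) : gbinom x j = Ring.choose x j := by
  rw [gbinom_eq_eval, Ring.choose_eq_smul, ← descPochhammer_map (Int.castRingHom ℝ),
    Polynomial.eval_map, div_eq_inv_mul, smul_eq_mul, Polynomial.eval₂_eq_sum,
    Polynomial.smeval_eq_sum]
  simp [Polynomial.sum_def, Polynomial.smul_pow]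

lemma gbinom_zero_right (x : ℝ) : gbinom x 0 = 1 := by simp [gbinom]

lemma gbinom_add (x y : ℝ) (k : ℕ) :
    gbinom (x + y) k = ∑ ij ∈ antidiagonal k, gbinom x ij.1 * gbinom y ij.2 := by
  simp only [gbinom_eq_choose]
  exact Ring.add_choose_eq k (Commute.all x y)

/-- Newton's interpolation formula with a Lagrange-type remainder. -/
lemma newton_remainder {p : ℕ} {F : ℕ → ℝ → ℝ} {l u a s : ℝ} {d : ℕ → ℝ}
    (hF : ∀ k < p, ∀ y ∈ Set.Icc l u, HasDerivAt (F k) (F (k + 1) y) y)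
    (ha : ∀ k < p, a + k ∈ Set.Icc l u) (hs : a + s ∈ Set.Icc l u)
    (hd : ∀ k < p, F 0 (a + k) = ∑ j ∈ range p, (k.choose j : ℝ) * d j) :
    ∃ ξ ∈ Set.Icc l u, F 0 (a + s) - ∑ j ∈ range p, gbinom s j * d j = gbinom s p * F p ξ := by
  by_cases hg : gbinom s p = 0
  · obtain ⟨i, hi, hsi⟩ : ∃ i < p, s = i := by
      have h := (div_eq_zero_iff.1 hg).resolve_right (by positivity)
      obtain ⟨i, hi, h⟩ := Finset.prod_eq_zero_iff.1 h
      exact ⟨i, Finset.mem_range.1 hi, sub_eq_zero.1 h⟩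
    refine ⟨a + s, hs, ?_⟩
    rw [hg, hsi, hd i hi]
    simp [gbinom_natCast]
  set c := (F 0 (a + s) - ∑ j ∈ range p, gbinom s j * d j) / gbinom s p with hc
  set Q : Polynomial ℝ := ∑ j ∈ range p, Polynomial.C (d j / j.factorial) * descPochhammer ℝ j +
    Polynomial.C (c / p.factorial) * descPochhammer ℝ p with hQ
  have hQeval (y : ℝ) : Q.eval y = ∑ j ∈ range p, gbinom y j * d j + gbinom y p * c := by
    simp only [hQ, Polynomial.eval_add, Polynomial.eval_finsetSum, Polynomial.eval_mul,
      Polynomial.eval_C, gbinom_eq_eval]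
    congr 1
    · exact Finset.sum_congr rfl fun j _ => by ring
    · ring
  have hQder : Polynomial.derivative^[p] Q = Polynomial.C c := by
    ext n
    rw [Polynomial.coeff_iterate_derivative, hQ, Polynomial.coeff_add, Polynomial.finsetSum_coeff]
    have hlow : ∑ j ∈ range p,
        (Polynomial.C (d j / j.factorial) * descPochhammer ℝ j).coeff (n + p) = 0 := by
      refine Finset.sum_eq_zero fun j hj => ?_
      rw [Polynomial.coeff_C_mul, Polynomial.coeff_eq_zero_of_natDegree_lt, mul_zero]
      rw [descPochhammer_natDegree]
      have := Finset.mem_range.1 hj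
      lia
    rw [hlow, zero_add, Polynomial.coeff_C_mul, Polynomial.coeff_C]
    split_ifs with hn
    · subst hn
      have h1 : (descPochhammer ℝ p).coeff p = 1 := by
        have := (monic_descPochhammer ℝ p).coeff_natDegree
        rwa [descPochhammer_natDegree] at this
      rw [zero_add, h1, Nat.descFactorial_self, nsmul_eq_mul]
      field_simp
    · rw [Polynomial.coeff_eq_zero_of_natDegree_lt (p := descPochhammer ℝ p)
        (by rw [descPochhammer_natDegree]; lia)]
      simp
  have hsk : ∀ k < p, s ≠ k := by
    intro k hk hsk
    apply hg
    rw [gbinom, Finset.prod_eq_zero (Finset.mem_range.2 hk) (by rw [hsk, sub_self]), zero_div]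
  set Z : Finset ℝ := insert (a + s) ((range p).image fun k : ℕ => a + (k : ℝ)) with hZ
  have hcard : Z.card = p + 1 := by
    rw [hZ, Finset.card_insert_of_notMem, Finset.card_image_of_injective, Finset.card_range]
    · intro i j hij
      simpa using hij
    · simp only [Finset.mem_image, Finset.mem_range, not_exists, not_and]
      intro k hk h
      exact hsk k hk (by linarith)
  have hmem (i : Fin (p + 1)) := Z.orderEmbOfFin_mem hcard i
  have hZprop : ∀ y ∈ Z, y ∈ Set.Icc l u ∧ F 0 y - Q.eval (y - a) = 0 := by
    intro y hy
    rw [hZ, Finset.mem_insert, Finset.mem_image] at hy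
    rcases hy with rfl | ⟨k, hk, rfl⟩
    · refine ⟨hs, ?_⟩
      rw [add_sub_cancel_left, hQeval, hc]
      field_simp
      ring
    · rw [Finset.mem_range] at hk
      refine ⟨ha k hk, ?_⟩
      rw [add_sub_cancel_left, hQeval, hd k hk]
      simp [gbinom_natCast, Nat.choose_eq_zero_of_lt hk]
  obtain ⟨ξ, hξ, h⟩ := exists_iterated_deriv_eq_zero (p := p) (l := l) (u := u)
    (F := fun k y => F k y - (Polynomial.derivative^[k] Q).eval (y - a))
    (fun k hk y hy => by
      refine (hF k hk y hy).sub ?_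
      rw [Function.iterate_succ_apply']
      exact ((Polynomial.derivative^[k] Q).hasDerivAt (y - a)).comp_sub_const y a)
    (Z.orderEmbOfFin hcard).strictMono (fun i => (hZprop _ (hmem i)).1)
    (fun i => (hZprop _ (hmem i)).2)
  refine ⟨ξ, hξ, ?_⟩
  rw [hQder, Polynomial.eval_C, sub_eq_zero] at h
  rw [h, hc, mul_div_cancel₀ _ hg]

lemma add_natCast_eq_sum {f : ℕ → ℝ → ℝ}
    (hrec : ∀ m, ∀ x > 0, f (m + 1) (x + 1) = f m x + f (m + 1) x) {a : ℝ} (ha : 0 < a)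
    {k p : ℕ} (hkp : k ≤ p) :
    f p (a + k) = ∑ j ∈ range (k + 1), (k.choose j : ℝ) * f (p - j) a := by
  induction k generalizing p with
  | zero => simp
  | succ k ih =>
    obtain ⟨p, rfl⟩ : ∃ r, p = r + 1 := ⟨p - 1, by lia⟩
    have h1 := hrec p (a + k) (by positivity)
    rw [ih (by lia), ih (by lia)] at h1
    rw [Nat.cast_succ, ← add_assoc, h1, Finset.sum_range_succ' _ (k + 1)]
    simp only [Nat.choose_succ_succ, Nat.cast_add, add_mul, Finset.sum_add_distrib,
      Nat.add_sub_add_right]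
    rw [add_assoc]
    congr 1
    rw [Finset.sum_range_succ (fun j => ((k.choose (j + 1) : ℕ) : ℝ) * f (p - j) a) k,
      Finset.sum_range_succ']
    simp

lemma add_natCast_eq_sum_of_lt {f : ℕ → ℝ → ℝ}
    (hrec : ∀ m, ∀ x > 0, f (m + 1) (x + 1) = f m x + f (m + 1) x) {a : ℝ} (ha : 0 < a)
    {k p : ℕ} (hkp : k < p) :
    f p (a + k) = ∑ j ∈ range p, (k.choose j : ℝ) * f (p - j) a := by
  rw [add_natCast_eq_sum hrec ha hkp.le]
  refine Finset.sum_subset (Finset.range_mono hkp) fun j _ hj => ?_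
  rw [Nat.choose_eq_zero_of_lt (by simpa using hj), Nat.cast_zero, zero_mul]

lemma log_sub_log_le {a b : ℝ} (ha : 0 < a) (hb : 0 < b) :
    Real.log a - Real.log b ≤ (a - b) / b := by
  rw [← Real.log_div ha.ne' hb.ne', sub_div, div_self hb.ne']
  exact Real.log_le_sub_one_of_pos (by positivity)

/-- The Newton interpolation error at the nodes `n, …, n + p` of a function with increasing
`p`-th derivative whose `p`-th difference is `log` tends to zero. -/
lemma tendsto_newton_error {f : ℕ → ℝ → ℝ} {p : ℕ} {s : ℝ}
    (hrec : ∀ m, ∀ x > 0, f (m + 1) (x + 1) = f m x + f (m + 1) x)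
    (hlog : ∀ x > 0, f 0 x = Real.log x) (hf : ContDiffOn ℝ (⊤ : ℕ∞) (f p) (Set.Ioi 0))
    (hmono : MonotoneOn (iteratedDerivWithin p (f p) (Set.Ioi 0)) (Set.Ioi 0)) (hs : 0 < s) :
    Tendsto (fun n : ℕ => f p (n + s) - ∑ j ∈ range (p + 1), gbinom s j * f (p - j) n)
      atTop (nhds 0) := by
  set D := iteratedDerivWithin p (f p) (Set.Ioi 0) with hD
  obtain ⟨q, hq⟩ := exists_nat_ge (max s p)
  have hsq : s ≤ q := (le_max_left _ _).trans hq
  have hpq : (p : ℝ) ≤ q := (le_max_right _ _).trans hq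
  have rem (a σ : ℝ) (ha : 0 < a) (hσ : 0 ≤ σ) (hσq : σ ≤ q) : ∃ ξ ∈ Set.Icc a (a + q),
      f p (a + σ) - ∑ j ∈ range p, gbinom σ j * f (p - j) a = gbinom σ p * D ξ := by
    have := newton_remainder (p := p) (l := a) (u := a + q) (a := a) (s := σ)
      (F := fun k => iteratedDerivWithin k (f p) (Set.Ioi 0)) (d := fun j => f (p - j) a)
      (fun k _ y hy => by
        have hy0 : (0 : ℝ) < y := ha.trans_le hy.1
        have hdiff := (hf.differentiableOn_iteratedDerivWithin (m := k)
          (by exact_mod_cast ENat.natCast_lt_top k) (uniqueDiffOn_Ioi 0)) y hy0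
        have := hdiff.hasDerivWithinAt
        rw [← iteratedDerivWithin_succ] at this
        exact this.hasDerivAt (Ioi_mem_nhds hy0))
      (fun k hk => by
        have : (k : ℝ) ≤ p := by exact_mod_cast hk.le
        constructor
        · linarith [(Nat.cast_nonneg k : (0 : ℝ) ≤ k)]
        · linarith)
      ⟨by linarith, by linarith⟩
      (fun k hk => by
        rw [iteratedDerivWithin_zero]
        exact add_natCast_eq_sum_of_lt hrec ha hk)
    simpa only [iteratedDerivWithin_zero] using this
  have remlog (a : ℝ) (ha : 0 < a) : ∃ ξ ∈ Set.Icc a (a + q), Real.log a = D ξ := by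
    obtain ⟨ξ, hξ, h⟩ := rem a p ha (by positivity) hpq
    refine ⟨ξ, hξ, ?_⟩
    rw [add_natCast_eq_sum hrec ha le_rfl, Finset.sum_range_succ] at h
    simpa [gbinom_natCast, hlog a ha] using h
  refine squeeze_zero_norm' (a := fun n : ℕ => |gbinom s p| * (q / ((n : ℝ) + (-q)))) ?_ ?_
  · filter_upwards [eventually_gt_atTop q] with n hn
    have hqn : (q : ℝ) < n := by exact_mod_cast hn
    have hq0 : (0 : ℝ) ≤ q := by positivity
    have hn0 : (0 : ℝ) < n := hq0.trans_lt hqn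
    have hnq : (0 : ℝ) < n - q := by linarith
    obtain ⟨ξ, hξ, h⟩ := rem n s hn0 hs.le hsq
    obtain ⟨η, hη, hlo⟩ := remlog (n - q) hnq
    obtain ⟨ζ, hζ, hup⟩ := remlog (n + q) (by positivity)
    have hξ0 : (0 : ℝ) < ξ := hn0.trans_le hξ.1
    have h1 : Real.log (n - q) ≤ D ξ := hlo ▸ hmono (Set.mem_Ioi.2 (hnq.trans_le hη.1)) hξ0
      (by linarith [hη.2, hξ.1])
    have h2 : D ξ ≤ Real.log (n + q) := hup ▸ hmono hξ0
      (Set.mem_Ioi.2 (by linarith [hζ.1])) (by linarith [hζ.1, hξ.2])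
    have h3 := log_sub_log_le (a := n + q) (b := n) (by positivity) hn0
    have h4 := log_sub_log_le (a := n) (b := n - q) hn0 hnq
    have h5 : (q : ℝ) / n ≤ q / (n - q) := by gcongr; linarith
    rw [add_sub_cancel_left] at h3
    rw [sub_sub_cancel] at h4
    rw [Finset.sum_range_succ, ← sub_sub, h, Nat.sub_self, hlog _ hn0, ← mul_sub, Real.norm_eq_abs,
      abs_mul, ← sub_eq_add_neg]
    gcongr
    rw [abs_le]
    constructor <;> linarith
  · have : Tendsto (fun n : ℕ => (n : ℝ) + (-q)) atTop atTop :=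
      tendsto_atTop_add_const_right _ _ tendsto_natCast_atTop_atTop
    simpa using (this.const_div_atTop (q : ℝ)).const_mul |gbinom s p|

/-- The Newton interpolation error of `y ↦ exp (-y t)` at `0, …, p`, divided by
`(exp (-t) - 1) ^ p * t`. -/
noncomputable def malmstenKernel (p : ℕ) (y t : ℝ) : ℝ :=
  (Real.exp (-(y * t)) - ∑ j ∈ range (p + 1), gbinom y j * (Real.exp (-t) - 1) ^ j) /
    ((Real.exp (-t) - 1) ^ p * t)

lemma exp_neg_sub_one_neg {t : ℝ} (ht : 0 < t) : Real.exp (-t) - 1 < 0 := by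
  rw [sub_neg, Real.exp_lt_one_iff]
  linarith

lemma abs_malmstenKernel_le {p : ℕ} {y l t : ℝ} (hl : l ≤ 0) (hly : l ≤ y) (ht : 0 < t) :
    |malmstenKernel p y t| ≤ |gbinom y (p + 1)| * ((1 + t) ^ p * Real.exp (-(l * t))) := by
  have hv := exp_neg_sub_one_neg ht
  obtain ⟨ξ, hξ, h⟩ := newton_remainder (p := p + 1) (l := l) (u := max p y) (a := 0) (s := y)
    (F := fun k z => (-t) ^ k * Real.exp (-t * z)) (d := fun j => (Real.exp (-t) - 1) ^ j)
    (fun k _ z _ => by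
      have := (((hasDerivAt_id z).const_mul (-t)).exp).const_mul ((-t) ^ k)
      exact this.congr_deriv (by rw [pow_succ, id]; ring))
    (fun k hk => by
      have h1 : (k : ℝ) ≤ p := by exact_mod_cast Nat.lt_succ_iff.1 hk
      have h2 : (0 : ℝ) ≤ k := k.cast_nonneg
      exact ⟨by linarith, by rw [zero_add]; exact h1.trans (le_max_left _ _)⟩)
    ⟨by linarith, by rw [zero_add]; exact le_max_right _ _⟩
    (fun k hk => by
      have h1 : Real.exp (-t * (0 + k)) = ((Real.exp (-t) - 1) + 1) ^ k := by
        rw [sub_add_cancel, ← Real.exp_nat_mul]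
        ring_nf
      rw [pow_zero, one_mul, h1, add_pow]
      simp only [one_pow, mul_one]
      simp_rw [mul_comm]
      refine Finset.sum_subset (Finset.range_mono hk) fun j _ hj => ?_
      rw [Nat.choose_eq_zero_of_lt (by simpa using hj), Nat.cast_zero, zero_mul])
  simp only [pow_zero, one_mul, zero_add] at h
  have hnum : malmstenKernel p y t =
      gbinom y (p + 1) * ((-t) ^ (p + 1) * Real.exp (-t * ξ)) / ((Real.exp (-t) - 1) ^ p * t) := by
    rw [malmstenKernel, ← h]
    ring_nf
  rw [hnum, abs_div, abs_mul, abs_mul, abs_mul, abs_pow, abs_pow, abs_neg, abs_of_pos ht,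
    Real.abs_exp, abs_of_neg hv, mul_div_assoc]
  refine mul_le_mul_of_nonneg_left ?_ (abs_nonneg _)
  have hv' : 0 < -(Real.exp (-t) - 1) := by linarith
  rw [div_le_iff₀ (by positivity)]
  have h1 : t ≤ (1 + t) * -(Real.exp (-t) - 1) := by
    have h2 : (1 + t) * Real.exp (-t) ≤ 1 := by
      rw [Real.exp_neg, ← div_eq_mul_inv, div_le_one (Real.exp_pos t)]
      linarith [Real.add_one_le_exp t]
    linarith
  have h3 : t ^ p ≤ (1 + t) ^ p * (-(Real.exp (-t) - 1)) ^ p := by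
    rw [← mul_pow]
    gcongr
  have h4 : Real.exp (-t * ξ) ≤ Real.exp (-(l * t)) := by
    rw [Real.exp_le_exp]
    nlinarith [hξ.1]
  calc t ^ (p + 1) * Real.exp (-t * ξ) = t ^ p * t * Real.exp (-t * ξ) := by ring
    _ ≤ ((1 + t) ^ p * (-(Real.exp (-t) - 1)) ^ p) * t * Real.exp (-(l * t)) := by gcongr
    _ = _ := by ring

lemma exists_abs_malmstenKernel_le (p : ℕ) {y l δ : ℝ} (hl : l ≤ 0) (hly : l ≤ y) (hδ : 0 < δ) :
    ∃ A, ∀ t > 0, |malmstenKernel p y t| ≤ A * Real.exp ((δ - l) * t) := by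
  refine ⟨|gbinom y (p + 1)| * (p.factorial / δ ^ p * Real.exp δ), fun t ht => ?_⟩
  refine (abs_malmstenKernel_le hl hly ht).trans ?_
  have h1 := Real.pow_div_factorial_le_exp (x := δ * (1 + t)) (by positivity) p
  have h2 : (1 + t) ^ p ≤ p.factorial / δ ^ p * Real.exp (δ * (1 + t)) := by
    rw [mul_pow, div_le_iff₀ (by positivity)] at h1
    rw [div_mul_eq_mul_div, le_div_iff₀ (by positivity)]
    linarith
  calc |gbinom y (p + 1)| * ((1 + t) ^ p * Real.exp (-(l * t)))
      ≤ |gbinom y (p + 1)| *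
        (p.factorial / δ ^ p * Real.exp (δ * (1 + t)) * Real.exp (-(l * t))) := by gcongr
    _ = |gbinom y (p + 1)| * (p.factorial / δ ^ p) *
        (Real.exp (δ * (1 + t)) * Real.exp (-(l * t))) := by ring
    _ = |gbinom y (p + 1)| * (p.factorial / δ ^ p) * (Real.exp δ * Real.exp ((δ - l) * t)) := by
      rw [← Real.exp_add, ← Real.exp_add]
      ring_nf
    _ = _ := by ring

lemma measurable_malmstenKernel (p : ℕ) (y : ℝ) : Measurable (malmstenKernel p y) := by
  unfold malmstenKernel
  fun_prop

lemma integrableOn_malmstenKernel (p : ℕ) {y c : ℝ} (hc : 0 < c) (hcy : 0 < c + y) :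
    IntegrableOn (fun t => malmstenKernel p y t * Real.exp (-(c * t))) (Set.Ioi 0) := by
  set l := min 0 y with hl
  have hcl : 0 < c + l := by
    rcases min_choice 0 y with h | h <;> rw [hl, h] <;> linarith
  obtain ⟨A, hA⟩ := exists_abs_malmstenKernel_le p (min_le_left 0 y) (min_le_right 0 y)
    (half_pos hcl)
  have hneg : -((c + l) / 2) < 0 := by linarith
  refine ((integrableOn_exp_mul_Ioi hneg 0).const_mul A).mono'
    ((measurable_malmstenKernel p y).mul (by fun_prop)).aestronglyMeasurable ?_
  refine (ae_restrict_iff' measurableSet_Ioi).2 (Eventually.of_forall fun t ht => ?_)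
  rw [norm_mul, Real.norm_eq_abs, Real.norm_eq_abs, Real.abs_exp]
  calc |malmstenKernel p y t| * Real.exp (-(c * t))
      ≤ A * Real.exp (((c + l) / 2 - l) * t) * Real.exp (-(c * t)) := by
        gcongr
        exact hA t ht
    _ = A * Real.exp (-((c + l) / 2) * t) := by
      rw [mul_assoc, ← Real.exp_add]
      ring_nf

lemma tendsto_integral_malmstenKernel (p : ℕ) {y : ℝ} (hy : 0 ≤ y) :
    Tendsto (fun n : ℕ => ∫ t in Set.Ioi (0 : ℝ), malmstenKernel p y t * Real.exp (-(n * t)))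
      atTop (nhds 0) := by
  obtain ⟨A, hA⟩ := exists_abs_malmstenKernel_le p le_rfl hy one_pos
  refine squeeze_zero_norm' (a := fun n : ℕ => A / ((n : ℝ) + (-1))) ?_ ?_
  · filter_upwards [eventually_gt_atTop 1] with n hn
    have hn1 : (1 : ℝ) < n := by exact_mod_cast hn
    have hneg : -((n : ℝ) - 1) < 0 := by linarith
    refine (norm_integral_le_of_norm_le ((integrableOn_exp_mul_Ioi hneg 0).const_mul A)
      ((ae_restrict_iff' measurableSet_Ioi).2 (Eventually.of_forall fun t ht => ?_))).trans ?_
    · rw [norm_mul, Real.norm_eq_abs, Real.norm_eq_abs, Real.abs_exp]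
      calc |malmstenKernel p y t| * Real.exp (-(n * t))
          ≤ A * Real.exp ((1 - 0) * t) * Real.exp (-(n * t)) := by
            gcongr
            exact hA t ht
        _ = A * Real.exp (-((n : ℝ) - 1) * t) := by
          rw [mul_assoc, ← Real.exp_add]
          ring_nf
    · rw [integral_const_mul, integral_exp_mul_Ioi hneg]
      simp [← sub_eq_add_neg, div_eq_mul_inv, ← inv_neg]
  · have : Tendsto (fun n : ℕ => (n : ℝ) + (-1)) atTop atTop :=
      tendsto_atTop_add_const_right _ _ tendsto_natCast_atTop_atTop
    exact this.const_div_atTop A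

lemma malmstenKernel_add (p : ℕ) (y z : ℝ) {t : ℝ} (ht : 0 < t) :
    malmstenKernel p (y + z) t = malmstenKernel p z t * Real.exp (-(y * t)) +
      ∑ j ∈ range (p + 1), gbinom z j * malmstenKernel (p - j) y t := by
  have hv := (exp_neg_sub_one_neg ht).ne
  set v := Real.exp (-t) - 1 with hvdef
  have hterm : ∀ j ∈ range (p + 1), gbinom z j * malmstenKernel (p - j) y t =
      (gbinom z j * v ^ j * Real.exp (-(y * t)) -
        ∑ i ∈ range (p + 1 - j), gbinom z j * v ^ j * (gbinom y i * v ^ i)) / (v ^ p * t) := by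
    intro j hj
    have hjp : j ≤ p := Nat.lt_succ_iff.1 (Finset.mem_range.1 hj)
    rw [malmstenKernel, ← hvdef, ← Finset.mul_sum, show p + 1 - j = p - j + 1 by lia,
      ← mul_div_assoc, div_eq_div_iff (by positivity) (by positivity),
      show v ^ p = v ^ (p - j) * v ^ j by rw [← pow_add, Nat.sub_add_cancel hjp]]
    ring
  have hconv : ∑ k ∈ range (p + 1), gbinom (y + z) k * v ^ k =
      ∑ j ∈ range (p + 1), ∑ i ∈ range (p + 1 - j), gbinom z j * v ^ j * (gbinom y i * v ^ i) := by
    rw [← Finset.sum_range_diag_flip (p + 1)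
      fun j i => gbinom z j * v ^ j * (gbinom y i * v ^ i)]
    refine Finset.sum_congr rfl fun k _ => ?_
    rw [add_comm y z, gbinom_add, Finset.Nat.sum_antidiagonal_eq_sum_range_succ
      (fun a b => gbinom z a * gbinom y b), Finset.sum_mul]
    refine Finset.sum_congr rfl fun j hj => ?_
    rw [show v ^ k = v ^ j * v ^ (k - j) by
      rw [← pow_add, Nat.add_sub_cancel' (Nat.lt_succ_iff.1 (Finset.mem_range.1 hj))]]
    ring
  rw [Finset.sum_congr rfl hterm, ← Finset.sum_div, Finset.sum_sub_distrib, ← hconv,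
    ← Finset.sum_mul, malmstenKernel, malmstenKernel, ← hvdef,
    show Real.exp (-((y + z) * t)) = Real.exp (-(y * t)) * Real.exp (-(z * t)) by
      rw [← Real.exp_add]; ring_nf]
  ring

lemma malmstenKernel_zero_left (y t : ℝ) :
    malmstenKernel 0 y t = (Real.exp (-(y * t)) - 1) / t := by
  simp [malmstenKernel, gbinom_zero_right]

lemma malmstenKernel_zero_right (p : ℕ) (t : ℝ) : malmstenKernel p 0 t = 0 := by
  have h := gbinom_natCast 0
  rw [Nat.cast_zero] at h
  rw [malmstenKernel, Finset.sum_range_succ']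
  simp [h]

/-- The integral of `-malmstenKernel p (x - 1) t * exp (-t)` over `(0, ∞)`. -/
noncomputable def malmstenIntegral (p : ℕ) (x : ℝ) : ℝ :=
  -∫ t in Set.Ioi (0 : ℝ), malmstenKernel p (x - 1) t * Real.exp (-t)

lemma integrableOn_malmstenKernel_sub_one (p : ℕ) {x : ℝ} (hx : 0 < x) :
    IntegrableOn (fun t => malmstenKernel p (x - 1) t * Real.exp (-t)) (Set.Ioi 0) := by
  simpa using integrableOn_malmstenKernel p (y := x - 1) one_pos (by linarith)

lemma malmstenIntegral_one (p : ℕ) : malmstenIntegral p 1 = 0 := by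
  simp [malmstenIntegral, malmstenKernel_zero_right]

lemma malmstenIntegral_add (p : ℕ) {y z : ℝ} (hy : 0 < y) (hz : 0 ≤ z) :
    malmstenIntegral p (y + z) =
      (∑ j ∈ range (p + 1), gbinom z j * malmstenIntegral (p - j) y) -
        ∫ t in Set.Ioi (0 : ℝ), malmstenKernel p z t * Real.exp (-(y * t)) := by
  have h : ∫ t in Set.Ioi (0 : ℝ), malmstenKernel p (y + z - 1) t * Real.exp (-t) =
      ∫ t in Set.Ioi (0 : ℝ), (malmstenKernel p z t * Real.exp (-(y * t)) +
        ∑ j ∈ range (p + 1), gbinom z j * (malmstenKernel (p - j) (y - 1) t * Real.exp (-t))) := by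
    refine setIntegral_congr_fun measurableSet_Ioi fun t ht => ?_
    rw [show y + z - 1 = (y - 1) + z by ring, malmstenKernel_add p _ _ ht, add_mul, mul_assoc,
      ← Real.exp_add, Finset.sum_mul]
    congr 1
    · ring_nf
    · exact Finset.sum_congr rfl fun j _ => by ring
  rw [malmstenIntegral, h, integral_add (integrableOn_malmstenKernel p hy (by linarith))
    (integrable_finsetSum _ fun j _ => (integrableOn_malmstenKernel_sub_one _ hy).const_mul _),
    integral_finsetSum _ fun j _ => (integrableOn_malmstenKernel_sub_one _ hy).const_mul _]
  simp only [integral_const_mul, malmstenIntegral, mul_neg, Finset.sum_neg_distrib]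
  ring

lemma malmstenKernel_succ_one (p : ℕ) (t : ℝ) : malmstenKernel (p + 1) 1 t = 0 := by
  have h := gbinom_natCast 1
  rw [Nat.cast_one] at h
  rw [malmstenKernel, Finset.sum_range_succ', Finset.sum_range_succ']
  simp [h, Nat.choose_eq_zero_of_lt]

lemma malmstenIntegral_add_one (p : ℕ) {x : ℝ} (hx : 0 < x) :
    malmstenIntegral (p + 1) (x + 1) = malmstenIntegral p x + malmstenIntegral (p + 1) x := by
  have h := gbinom_natCast 1
  rw [Nat.cast_one] at h
  rw [malmstenIntegral_add _ hx zero_le_one, Finset.sum_range_succ', Finset.sum_range_succ']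
  simp [h, malmstenKernel_succ_one, Nat.choose_eq_zero_of_lt]

lemma malmstenIntegral_zero {x : ℝ} (hx : 0 < x) : malmstenIntegral 0 x = Real.log x := by
  have heq (t : ℝ) : -(malmstenKernel 0 (x - 1) t * Real.exp (-t)) =
      t⁻¹ • (Real.exp (-(1 * t)) - Real.exp (-(x * t))) := by
    rw [malmstenKernel_zero_left, show -(x * t) = -((x - 1) * t) + -t by ring, Real.exp_add,
      one_mul, smul_eq_mul]
    ring
  have hint := (integrableOn_malmstenKernel_sub_one 0 hx).neg
  have hcont : Continuous fun t : ℝ => Real.exp (-t) := by fun_prop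
  have h0 : Tendsto (fun t : ℝ => Real.exp (-t)) (nhdsWithin 0 (Set.Ioi 0)) (nhds 1) := by
    simpa using (hcont.tendsto 0).mono_left nhdsWithin_le_nhds
  have := Frullani.integral_Ioi_eq (f := fun t => Real.exp (-t)) (a := 1) (b := x)
    (hcont.locallyIntegrable.locallyIntegrableOn _) one_pos hx h0
    (Real.tendsto_exp_neg_atTop_nhds_zero)
    (hint.congr_fun (fun t _ => heq t) measurableSet_Ioi)
  rw [malmstenIntegral, ← integral_neg]
  simp_rw [heq]
  simpa using this

/-- A multiple-gamma sequence is given by the Malmstén-type integrals. -/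
lemma IsMultipleGammaSeq.log_eq_malmstenIntegral {G : ℕ → ℝ → ℝ} (hG : IsMultipleGammaSeq G)
    (p : ℕ) {x : ℝ} (hx : 0 < x) : Real.log (G p x) = malmstenIntegral p x := by
  obtain ⟨hpos, hsmooth, hzero, hrec, hone, hmono⟩ := hG
  set f : ℕ → ℝ → ℝ := fun m x => Real.log (G m x) with hf
  have hfrec (m : ℕ) (x : ℝ) (hx : 0 < x) : f (m + 1) (x + 1) = f m x + f (m + 1) x := by
    simp only [hf]
    rw [hrec m x hx, Real.log_mul (hpos _ _ hx).ne' (hpos _ _ hx).ne']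
  have hflog (x : ℝ) (hx : 0 < x) : f 0 x = Real.log x := by simp only [hf, hzero x hx]
  change f p x = _
  induction p using Nat.strong_induction_on generalizing x with
  | _ p ih =>
  obtain rfl | ⟨p, rfl⟩ : p = 0 ∨ ∃ r, p = r + 1 := by
    cases p <;> simp
  · rw [hflog x hx, malmstenIntegral_zero hx]
  set h : ℝ → ℝ := fun y => f (p + 1) y - malmstenIntegral (p + 1) y with hh
  have hper (n : ℕ) {y : ℝ} (hy : 0 < y) : h (n + y) = h y := by
    induction n with
    | zero => simp
    | succ n ihn =>
      have hny : (0 : ℝ) < n + y := by positivity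
      rw [← ihn, Nat.cast_succ, show (n : ℝ) + 1 + y = n + y + 1 by ring]
      simp only [hh]
      rw [hfrec p _ hny, malmstenIntegral_add_one p hny, ih p (by lia) hny]
      ring
  have hnat (n : ℕ) (hn : 0 < n) : f (p + 1) n = malmstenIntegral (p + 1) n := by
    obtain ⟨k, rfl⟩ : ∃ k, n = k + 1 := ⟨n - 1, by lia⟩
    have h1 := hper k one_pos
    simp only [hh, malmstenIntegral_one] at h1
    have h2 : f (p + 1) 1 = 0 := by simp only [hf, hone, Real.log_one]
    rw [h2, sub_zero, sub_eq_zero] at h1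
    rw [Nat.cast_succ, h1]
  have hlim1 := tendsto_newton_error (p := p + 1) hfrec hflog
    (ContDiffOn.log (hsmooth _) fun x hx => (hpos _ x hx).ne') (hmono (p + 1)).monotoneOn hx
  have hlim2 := hlim1.add (tendsto_integral_malmstenKernel (p + 1) hx.le)
  rw [add_zero] at hlim2
  have hlim3 : Tendsto (fun _ : ℕ => h x) atTop (nhds 0) := by
    refine hlim2.congr' ?_
    filter_upwards [eventually_gt_atTop 0] with n hn
    have hn0 : (0 : ℝ) < n := by exact_mod_cast hn
    rw [← hper n hx]
    simp only [hh]
    rw [malmstenIntegral_add _ hn0 hx.le]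
    have hsum : ∑ j ∈ range (p + 1 + 1), gbinom x j * f (p + 1 - j) n =
        ∑ j ∈ range (p + 1 + 1), gbinom x j * malmstenIntegral (p + 1 - j) n := by
      refine Finset.sum_congr rfl fun j _ => ?_
      rcases Nat.eq_zero_or_pos j with rfl | hj
      · rw [Nat.sub_zero, hnat n hn]
      · rw [ih _ (by lia) hn0]
    rw [hsum]
    ring
  exact sub_eq_zero.1 (tendsto_nhds_unique tendsto_const_nhds hlim3)

lemma malmsten_integrand_eq (m : ℕ) (x : ℝ) {t : ℝ} (ht : 0 < t) :
    (gbinom (x - 1) (m + 1) -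
        (Real.exp ((1 - x) * t) - 1) / (Real.exp (-t) - 1) ^ (m + 1) +
        ∑ j ∈ Finset.Icc 1 m, gbinom (x - 1) j / (Real.exp (-t) - 1) ^ (m + 1 - j)) *
        (Real.exp (-t) / t) = -(malmstenKernel (m + 1) (x - 1) t * Real.exp (-t)) := by
  have hv := (exp_neg_sub_one_neg ht).ne
  have hterm : ∑ j ∈ Finset.Icc 1 m, gbinom (x - 1) j / (Real.exp (-t) - 1) ^ (m + 1 - j) =
      (∑ j ∈ Finset.Icc 1 m, gbinom (x - 1) j * (Real.exp (-t) - 1) ^ j) /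
        (Real.exp (-t) - 1) ^ (m + 1) := by
    rw [Finset.sum_div]
    refine Finset.sum_congr rfl fun j hj => ?_
    rw [div_eq_div_iff (by positivity) (by positivity), mul_assoc, ← pow_add,
      Nat.add_sub_cancel' (by have := (Finset.mem_Icc.1 hj).2; lia)]
  have hsum : ∑ j ∈ range (m + 1 + 1), gbinom (x - 1) j * (Real.exp (-t) - 1) ^ j =
      1 + ∑ j ∈ Finset.Icc 1 m, gbinom (x - 1) j * (Real.exp (-t) - 1) ^ j +
        gbinom (x - 1) (m + 1) * (Real.exp (-t) - 1) ^ (m + 1) := by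
    rw [Finset.sum_range_succ, Finset.range_eq_Ico, Finset.sum_eq_sum_Ico_succ_bot (by lia),
      gbinom_zero_right, pow_zero, one_mul]
    rfl
  rw [hterm, malmstenKernel, hsum, show -((x - 1) * t) = (1 - x) * t by ring]
  field_simp
  ring

/-- Generalization of Malmstén's formula: an integral representation of `ln G_{m+1}`. -/
theorem stmt_14 (G : ℕ → ℝ → ℝ) (hG : IsMultipleGammaSeq G) (m : ℕ) (x : ℝ) (hx : 0 < x) :
    MeasureTheory.IntegrableOn (fun t : ℝ =>
      (gbinom (x - 1) (m + 1) -
        (Real.exp ((1 - x) * t) - 1) / (Real.exp (-t) - 1) ^ (m + 1) +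
        ∑ j ∈ Finset.Icc 1 m, gbinom (x - 1) j / (Real.exp (-t) - 1) ^ (m + 1 - j)) *
        (Real.exp (-t) / t)) (Set.Ioi 0) ∧
    Real.log (G (m + 1) x) = ∫ t in Set.Ioi (0 : ℝ),
      (gbinom (x - 1) (m + 1) -
        (Real.exp ((1 - x) * t) - 1) / (Real.exp (-t) - 1) ^ (m + 1) +
        ∑ j ∈ Finset.Icc 1 m, gbinom (x - 1) j / (Real.exp (-t) - 1) ^ (m + 1 - j)) *
        (Real.exp (-t) / t) := by
  constructor
  · exact (integrableOn_malmstenKernel_sub_one (m + 1) hx).neg.congr_fun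
      (fun t ht => (malmsten_integrand_eq m x ht).symm) measurableSet_Ioi
  · rw [hG.log_eq_malmstenIntegral (m + 1) hx, malmstenIntegral, ← integral_neg]
    exact setIntegral_congr_fun measurableSet_Ioi fun t ht => (malmsten_integrand_eq m x ht).symm
end
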